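/- Suppose the social welfare function Φ satisfies restricted monotonicity. Let p ∈ R̄^I and i ∈ I_p. Then ψ(p) ≡ α·ψ(p_{∼i}) + β·u_i for some α, β ∈ ℝ. Moreover, if u_i is equivalent neither to ψ(p_{∼i}) nor to −ψ(p_{∼i}), and ψ(p_{∼i}) is not equivalent to 0, then β > 0 and the pair (α, β) is unique up to multiplication by a common positive factor. -/

import Mathlib

open MeasureTheory

/-- An act: a measurable map from states to outcomes. -/
abbrev Act (Ω O : Type*) [MeasurableSpace Ω] [MeasurableSpace O] : Type _ :=
  {f : Ω → O // Measurable f}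

/-- Non-atomicity of a measure relative to an explicit σ-algebra `m'`:
for every `m'`-measurable set of positive measure there is an `m'`-measurable
subset of strictly smaller positive measure. -/
def NonatomicOn {Ω : Type*} [MeasurableSpace Ω] (π : MeasureTheory.Measure Ω)
    (m' : MeasurableSpace Ω) : Prop :=
  ∀ E : Set Ω, MeasurableSet[m'] E → 0 < π E →
    ∃ F : Set Ω, MeasurableSet[m'] F ∧ F ⊆ E ∧ 0 < π F ∧ π F < π E

section Framework

variable {Ω O I : Type*} [mΩ : MeasurableSpace Ω] [mO : MeasurableSpace O]

/-- A belief: a non-atomic (countably additive) probability measure. -/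
def IsBelief (π : Measure Ω) : Prop :=
  IsProbabilityMeasure π ∧ NonatomicOn π mΩ

/-- A utility function: a bounded measurable function on outcomes. -/
def IsUtility (u : O → ℝ) : Prop :=
  Measurable u ∧ ∃ M : ℝ, ∀ x, |u x| ≤ M

/-- A normalized utility function: measurable with infimum 0 and supremum 1. -/
def NormalizedUtility (u : O → ℝ) : Prop :=
  Measurable u ∧ IsGLB (Set.range u) 0 ∧ IsLUB (Set.range u) 1

/-- Member of `𝒰̄`: normalized or identically zero. -/
def NormalizedUtilityBar (u : O → ℝ) : Prop :=
  NormalizedUtility u ∨ u = 0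

/-- Subjective expected utility of an act. -/
noncomputable def ev (π : Measure Ω) (u : O → ℝ) (f : Act Ω O) : ℝ :=
  ∫ ω, u (f.1 ω) ∂π

/-- Preference relations over acts. -/
abbrev Pref (Ω O : Type*) [MeasurableSpace Ω] [MeasurableSpace O] :=
  Act Ω O → Act Ω O → Prop

/-- `(π, u)` represents `r`: `f ≿ g` iff the expected utility of `f` is at least
that of `g`. -/
def Represents (π : Measure Ω) (u : O → ℝ) (r : Pref Ω O) : Prop :=
  ∀ f g : Act Ω O, r f g ↔ ev π u g ≤ ev π u f

/-- A normalized representation: a belief together with a normalized (or zero)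
utility function representing the relation. -/
def NormRep (π : Measure Ω) (u : O → ℝ) (r : Pref Ω O) : Prop :=
  IsBelief π ∧ NormalizedUtilityBar u ∧ Represents π u r

/-- Membership in `R̄`: the relation maximizes subjective expected utility. -/
def IsSEU (r : Pref Ω O) : Prop :=
  ∃ (π : Measure Ω) (u : O → ℝ), IsBelief π ∧ IsUtility u ∧ Represents π u r

/-- Complete indifference: the relation with empty strict part. -/
def CompletelyIndifferent (r : Pref Ω O) : Prop :=
  ∀ f g : Act Ω O, r f g

/-- `π` is a belief representing `r` (together with some utility function). -/
def RepresentsBelief (π : Measure Ω) (r : Pref Ω O) : Prop :=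
  IsBelief π ∧ ∃ u : O → ℝ, IsUtility u ∧ Represents π u r

/-- A preference profile: every agent's relation is SEU-maximizing. -/
def IsProfile (p : I → Pref Ω O) : Prop := ∀ i, IsSEU (p i)

/-- The completely indifferent relation. -/
def indiffRel : Pref Ω O := fun _ _ => True

open Classical in
/-- `p_{∼i}`: replace agent `i`'s relation by complete indifference. -/
noncomputable def updIndiff (p : I → Pref Ω O) (i : I) : I → Pref Ω O :=
  fun j => if j = i then indiffRel else p j

/-- `p_{∼{i,j}}`. -/
noncomputable def updIndiffPair (p : I → Pref Ω O) (i j : I) : I → Pref Ω O :=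
  updIndiff (updIndiff p i) j

open Classical in
/-- `I_p`: the set of concerned agents. -/
noncomputable def concerned [Fintype I] (p : I → Pref Ω O) : Finset I :=
  Finset.univ.filter fun i => ¬ CompletelyIndifferent (p i)

/-- Equivalence of utility functions: equality up to a positive affine
transformation. -/
def UEquiv (u v : O → ℝ) : Prop :=
  ∃ a : ℝ, 0 < a ∧ ∃ b : ℝ, ∀ x, u x = a * v x + b

/-- The beliefs `(πa i)_{i ∈ J}` are affinely independent. -/
def BeliefsAffIndep (J : Finset I) (πa : I → Measure Ω) : Prop :=
  ∀ c : I → ℝ, (∑ i ∈ J, c i) = 0 →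
    (∀ E : Set Ω, MeasurableSet E → (∑ i ∈ J, c i * (πa i E).toReal) = 0) →
    ∀ i ∈ J, c i = 0

/-- The utility functions `(ua i)_{i ∈ J}` are linearly independent: no
nontrivial linear combination of them is a constant function. -/
def UtilsLinIndep (J : Finset I) (ua : I → O → ℝ) : Prop :=
  ∀ c : I → ℝ, (∃ b : ℝ, ∀ x, (∑ i ∈ J, c i * ua i x) = b) → ∀ i ∈ J, c i = 0

/-- The profile has non-degenerate beliefs: the beliefs of any pair and any
triple of concerned agents are affinely independent. -/
def NonDegenerateBeliefs [Fintype I] (p : I → Pref Ω O) (πa : I → Measure Ω) : Prop :=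
  ∀ J : Finset I, J ⊆ concerned p → (J.card = 2 ∨ J.card = 3) → BeliefsAffIndep J πa

/-- The profile has non-degenerate utilities: the utility functions of any pair
and any triple of concerned agents are linearly independent. -/
def NonDegenerateUtils [Fintype I] (p : I → Pref Ω O) (ua : I → O → ℝ) : Prop :=
  ∀ J : Finset I, J ⊆ concerned p → (J.card = 2 ∨ J.card = 3) → UtilsLinIndep J ua

/-- The belief dimension of the beliefs `(πa i)_{i ∈ J}` is at least `n`. -/
def BeliefDimAtLeast (n : ℕ) (J : Finset I) (πa : I → Measure Ω) : Prop :=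
  ∃ E : Fin n → Set Ω, (∀ k, MeasurableSet (E k)) ∧
    ∀ c : Fin n → ℝ, (∀ i ∈ J, (∑ k, c k * (πa i (E k)).toReal) = 0) → ∀ k, c k = 0

/-- The utility dimension of the utility functions `(ua i)_{i ∈ J}` is at
least `n`. -/
def UtilDimAtLeast (n : ℕ) (J : Finset I) (ua : I → O → ℝ) : Prop :=
  ∃ q : Fin n → Measure O, (∀ k, IsProbabilityMeasure (q k)) ∧
    ∀ c : Fin n → ℝ, (∀ i ∈ J, (∑ k, c k * ∫ x, ua i x ∂(q k)) = 0) → ∀ k, c k = 0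

open Classical in
/-- The expected utility function of an SEU relation (via a choice of a
normalized representation). -/
noncomputable def evOf (r : Pref Ω O) : Act Ω O → ℝ :=
  if h : ∃ π : Measure Ω, ∃ u : O → ℝ, NormRep π u r then
    fun f => ev h.choose h.choose_spec.choose f
  else fun _ => 0

/-- The uniform metric on `R`. -/
noncomputable def prefDist (r r' : Pref Ω O) : ℝ :=
  ⨆ f : Act Ω O, |evOf r f - evOf r' f|

/-- Continuity of a real-valued function on `R` with respect to the uniform
metric. -/
def ContOnR (h : Pref Ω O → ℝ) : Prop :=
  ∀ r : Pref Ω O, IsSEU r → ¬ CompletelyIndifferent r →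
    ∀ ε : ℝ, 0 < ε → ∃ δ : ℝ, 0 < δ ∧
      ∀ r' : Pref Ω O, IsSEU r' → ¬ CompletelyIndifferent r' →
        prefDist r r' < δ → |h r' - h r| < ε

/-- Open sets of `R̄`: the whole space `R̄` together with the metrically open
subsets of `R`. -/
def OpenInRbar (S : Set (Pref Ω O)) : Prop :=
  S = {r | IsSEU r} ∨
    ∀ r ∈ S, IsSEU r ∧ ¬ CompletelyIndifferent r ∧
      ∃ ε : ℝ, 0 < ε ∧ ∀ r' : Pref Ω O, IsSEU r' → ¬ CompletelyIndifferent r' →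
        prefDist r r' < ε → r' ∈ S

/-- Restricted monotonicity (on a domain `D` of profiles). -/
def RestrictedMonotonicityOn (D : (I → Pref Ω O) → Prop)
    (Φ : (I → Pref Ω O) → Pref Ω O) : Prop :=
  ∀ (i : I) (p : I → Pref Ω O), D p →
    ∀ πsi πi : Measure Ω,
      RepresentsBelief πsi (Φ (updIndiff p i)) → RepresentsBelief πi (p i) →
      ∀ f g : Act Ω O,
        Φ (updIndiff p i) f g → Φ (updIndiff p i) g f →
        Measure.map f.1 πsi = Measure.map f.1 πi →
        Measure.map g.1 πsi = Measure.map g.1 πi →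
        (p i f g → Φ p f g) ∧ ((p i f g ∧ ¬ p i g f) → (Φ p f g ∧ ¬ Φ p g f))

abbrev RestrictedMonotonicity (Φ : (I → Pref Ω O) → Pref Ω O) : Prop :=
  RestrictedMonotonicityOn IsProfile Φ

/-- Faithfulness (on a domain `D`). -/
def FaithfulOn (D : (I → Pref Ω O) → Prop) (Φ : (I → Pref Ω O) → Pref Ω O) : Prop :=
  ∀ p : I → Pref Ω O, D p → (∀ i, CompletelyIndifferent (p i)) →
    CompletelyIndifferent (Φ p)

abbrev Faithful (Φ : (I → Pref Ω O) → Pref Ω O) : Prop := FaithfulOn IsProfile Φ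

/-- No belief imposition (on a domain `D`). -/
def NoBeliefImpositionOn (D : (I → Pref Ω O) → Prop)
    (Φ : (I → Pref Ω O) → Pref Ω O) : Prop :=
  ∀ (i : I) (p : I → Pref Ω O), D p →
    ¬ CompletelyIndifferent (Φ (updIndiff p i)) →
    ¬ CompletelyIndifferent (Φ p) →
    ¬ CompletelyIndifferent (p i) →
    ∀ πsi π πi : Measure Ω,
      RepresentsBelief πsi (Φ (updIndiff p i)) →
      RepresentsBelief π (Φ p) → RepresentsBelief πi (p i) →
      πsi ≠ πi → π ≠ πi

abbrev NoBeliefImposition (Φ : (I → Pref Ω O) → Pref Ω O) : Prop :=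
  NoBeliefImpositionOn IsProfile Φ

/-- Continuity of an SWF (on a domain `D`), with respect to the topology of
`R̄` and the product topology on profiles. -/
def ContinuousSWFOn (D : (I → Pref Ω O) → Prop)
    (Φ : (I → Pref Ω O) → Pref Ω O) : Prop :=
  ∀ S : Set (Pref Ω O), OpenInRbar S →
    ∀ p : I → Pref Ω O, D p → Φ p ∈ S →
      ∃ T : I → Set (Pref Ω O), (∀ i, OpenInRbar (T i)) ∧ (∀ i, p i ∈ T i) ∧
        ∀ q : I → Pref Ω O, D q → (∀ i, q i ∈ T i) → Φ q ∈ S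

abbrev ContinuousSWF (Φ : (I → Pref Ω O) → Pref Ω O) : Prop :=
  ContinuousSWFOn IsProfile Φ

/-- Anonymity (on a domain `D`). -/
def AnonymousOn (D : (I → Pref Ω O) → Prop)
    (Φ : (I → Pref Ω O) → Pref Ω O) : Prop :=
  ∀ p : I → Pref Ω O, D p → ∀ η : Equiv.Perm I, Φ (fun i => p (η i)) = Φ p

abbrev Anonymous (Φ : (I → Pref Ω O) → Pref Ω O) : Prop := AnonymousOn IsProfile Φ

/-- The regular set of acts `𝒜(ℰ', O')`. -/
def RegularActs (m' : MeasurableSpace Ω) (O' : Set O) : Set (@Act Ω O mΩ mO) :=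
  {f : @Act Ω O mΩ mO | @Measurable Ω O m' mO f.1 ∧ Set.range f.1 ⊆ O'}

/-- `𝒜(ℰ', O')` is co-redundant for `p` (with representing beliefs `πa`). -/
def CoRedundant (m' : MeasurableSpace Ω) (O' : Set O)
    (p : I → @Pref Ω O mΩ mO) (πa : I → @MeasureTheory.Measure Ω mΩ) : Prop :=
  (∀ f : @Act Ω O mΩ mO, ∃ g ∈ @RegularActs Ω O mΩ mO m' O', ∀ i, p i f g ∧ p i g f) ∧
  (∀ i, @NonatomicOn Ω mΩ (πa i) m')

/-- Independence of redundant acts (on a domain `D`). -/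
def IndepRedundantActsOn (D : (I → Pref Ω O) → Prop)
    (Φ : (I → Pref Ω O) → Pref Ω O) : Prop :=
  ∀ (p p' : I → Pref Ω O) (πa πa' : I → Measure Ω),
    D p → D p' →
    (∀ i, RepresentsBelief (πa i) (p i)) →
    (∀ i, RepresentsBelief (πa' i) (p' i)) →
    ∀ (m' : {m : MeasurableSpace Ω // m ≤ mΩ}) (O' : Set O),
      CoRedundant m'.1 O' p πa → CoRedundant m'.1 O' p' πa' →
      (∀ i : I, ∀ f ∈ RegularActs m'.1 O', ∀ g ∈ RegularActs m'.1 O',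
        (p i f g ↔ p' i f g)) →
      ∀ f ∈ RegularActs m'.1 O', ∀ g ∈ RegularActs m'.1 O',
        (Φ p f g ↔ Φ p' f g)

abbrev IndepRedundantActs (Φ : (I → Pref Ω O) → Pref Ω O) : Prop :=
  IndepRedundantActsOn IsProfile Φ

/-- The weighted average of the concerned agents' beliefs with weights `v`. -/
noncomputable def mixBelief [Fintype I] (p : I → Pref Ω O) (πa : I → Measure Ω)
    (v : I → ℝ) : Measure Ω :=
  (ENNReal.ofReal ((∑ i ∈ concerned p, v i)⁻¹)) •
    ∑ i ∈ concerned p, ENNReal.ofReal (v i) • πa i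

/-- The weighted sum of the concerned agents' utility functions with weights
`w`. -/
noncomputable def mixUtil [Fintype I] (p : I → Pref Ω O) (ua : I → O → ℝ)
    (w : I → ℝ) : O → ℝ :=
  fun x => ∑ i ∈ concerned p, w i * ua i x

/-- A common utility profile: every concerned agent's normalized utility
function is equivalent to `u` or to `-u` for a single `u ∈ 𝒰`. -/
def CommonUtilityProfile [Fintype I] (p : I → Pref Ω O) (ua : I → O → ℝ) : Prop :=
  ∃ u : O → ℝ, NormalizedUtility u ∧
    ∀ i ∈ concerned p, UEquiv (ua i) u ∨ UEquiv (ua i) (fun x => - u x)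

end Framework

/-- Non-atomicity in terms of real-valued measure. -/
def RNonatomic {Ω : Type*} [MeasurableSpace Ω] (σ : Measure Ω) : Prop :=
  ∀ E : Set Ω, MeasurableSet E → 0 < σ.real E →
    ∃ F : Set Ω, MeasurableSet F ∧ F ⊆ E ∧ 0 < σ.real F ∧ σ.real F < σ.real E

lemma rnonatomic_small {Ω : Type*} [MeasurableSpace Ω] (σ : Measure Ω) [IsFiniteMeasure σ]
    (h : RNonatomic σ) (n : ℕ) : ∀ E : Set Ω, MeasurableSet E → 0 < σ.real E →
    ∃ F : Set Ω, MeasurableSet F ∧ F ⊆ E ∧ 0 < σ.real F ∧ σ.real F ≤ σ.real E * (1/2)^n := by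
  induction n with
  | zero => intro E hE hpos; exact ⟨E, hE, subset_rfl, hpos, by simp⟩
  | succ n ih =>
    intro E hE hpos
    obtain ⟨G, hG, hGE, hG0, hG1⟩ := ih E hE hpos
    obtain ⟨F, hF, hFG, hF0, hF1⟩ := h G hG hG0
    have hd : σ.real (G \ F) = σ.real G - σ.real F := measureReal_sdiff hFG hF
    by_cases hc : σ.real F ≤ σ.real G / 2
    · refine ⟨F, hF, hFG.trans hGE, hF0, ?_⟩
      rw [pow_succ]; linarith
    · refine ⟨G \ F, hG.diff hF, Set.sdiff_subset.trans hGE, by linarith, ?_⟩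
      rw [pow_succ]; linarith

lemma real_tendsto_iUnion {Ω : Type*} [MeasurableSpace Ω] (σ : Measure Ω) [IsFiniteMeasure σ]
    (A : ℕ → Set Ω) (hA : Monotone A) :
    Filter.Tendsto (fun n => σ.real (A n)) Filter.atTop (nhds (σ.real (⋃ n, A n))) := by
  have := tendsto_measure_iUnion_atTop (μ := σ) hA
  exact (ENNReal.tendsto_toReal (measure_ne_top _ _)).comp this

lemma sierpinski {Ω : Type*} [MeasurableSpace Ω] (σ : Measure Ω) [IsFiniteMeasure σ]
    (h : RNonatomic σ) (E : Set Ω) (hE : MeasurableSet E) (c : ℝ) (hc0 : 0 ≤ c)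
    (hc1 : c ≤ σ.real E) : ∃ F : Set Ω, MeasurableSet F ∧ F ⊆ E ∧ σ.real F = c := by
  let T := {A : Set Ω // MeasurableSet A ∧ A ⊆ E ∧ σ.real A ≤ c}
  have step : ∀ A : T, ∃ A' : T, A.1 ⊆ A'.1 ∧
      ∀ B : T, A.1 ⊆ B.1 → σ.real B.1 - σ.real A.1 ≤ 2 * (σ.real A'.1 - σ.real A.1) := by
    intro A
    let S : Set ℝ := {r | ∃ B : T, A.1 ⊆ B.1 ∧ r = σ.real B.1}
    have hbdd : BddAbove S := ⟨c, by rintro r ⟨B, _, rfl⟩; exact B.2.2.2⟩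
    have hne : S.Nonempty := ⟨_, A, subset_rfl, rfl⟩
    by_cases hs : sSup S ≤ σ.real A.1
    · refine ⟨A, subset_rfl, fun B hB => ?_⟩
      have := le_csSup hbdd (show σ.real B.1 ∈ S from ⟨B, hB, rfl⟩)
      linarith
    · push Not at hs
      obtain ⟨_, ⟨A', hA', rfl⟩, hlt⟩ :=
        exists_lt_of_lt_csSup hne (show (sSup S + σ.real A.1) / 2 < sSup S by linarith)
      refine ⟨A', hA', fun B hB => ?_⟩
      have := le_csSup hbdd (show σ.real B.1 ∈ S from ⟨B, hB, rfl⟩)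
      linarith
  choose nxt hn1 hn2 using step
  let A0 : T := ⟨∅, MeasurableSet.empty, Set.empty_subset _, by simpa using hc0⟩
  let A : ℕ → T := fun n => Nat.rec A0 (fun _ B => nxt B) n
  have hAs : ∀ n, A (n+1) = nxt (A n) := fun n => rfl
  have hmono : Monotone (fun n => (A n).1) := monotone_nat_of_le_succ (fun n => hn1 (A n))
  have hlim := real_tendsto_iUnion σ _ hmono
  set F := ⋃ n, (A n).1 with hF
  have hFm : MeasurableSet F := MeasurableSet.iUnion fun n => (A n).2.1
  have hFE : F ⊆ E := Set.iUnion_subset fun n => (A n).2.2.1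
  have hFc : σ.real F ≤ c := le_of_tendsto' hlim fun n => (A n).2.2.2
  refine ⟨F, hFm, hFE, ?_⟩
  by_contra hne
  have hlt : σ.real F < c := lt_of_le_of_ne hFc hne
  have hd : σ.real (E \ F) = σ.real E - σ.real F := measureReal_sdiff hFE hFm
  have hpos : 0 < σ.real (E \ F) := by linarith
  obtain ⟨n, hn⟩ : ∃ n : ℕ, σ.real (E \ F) * (1/2)^n < c - σ.real F := by
    have ht : Filter.Tendsto (fun n : ℕ => σ.real (E \ F) * (1/2 : ℝ)^n) Filter.atTop
        (nhds (σ.real (E \ F) * 0)) :=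
      (tendsto_pow_atTop_nhds_zero_of_lt_one (by norm_num) (by norm_num)).const_mul _
    rw [mul_zero] at ht
    exact (ht.eventually_lt_const (by linarith : 0 < c - σ.real F)).exists
  obtain ⟨G, hG, hGE, hG0, hG1⟩ := rnonatomic_small σ h n _ (hE.diff hFm) hpos
  have hdisj : Disjoint F G := Set.disjoint_left.2 fun x hx hx' => (hGE hx').2 hx
  have hu : σ.real (F ∪ G) = σ.real F + σ.real G := measureReal_union hdisj hG
  let B : T := ⟨F ∪ G, hFm.union hG, Set.union_subset hFE (hGE.trans Set.sdiff_subset),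
    by rw [hu]; linarith⟩
  have hB : ∀ n, σ.real (F ∪ G) - σ.real (A n).1 ≤
      2 * (σ.real (A (n+1)).1 - σ.real (A n).1) := fun n =>
    hn2 (A n) B ((Set.subset_iUnion (fun n => (A n).1) n).trans Set.subset_union_left)
  have hlim' := (Filter.tendsto_add_atTop_iff_nat 1).2 hlim
  have := le_of_tendsto_of_tendsto' (hlim.const_sub (σ.real (F ∪ G)))
    ((hlim'.sub hlim).const_mul 2) hB
  linarith

/-- Every measurable set can be halved simultaneously for all measures in `S`. -/
def Halving {Ω : Type*} [MeasurableSpace Ω] (S : Set (Measure Ω)) : Prop :=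
  ∀ E : Set Ω, MeasurableSet E → ∃ F : Set Ω, MeasurableSet F ∧ F ⊆ E ∧
    ∀ ν ∈ S, ν.real F = ν.real E / 2

lemma halving_family {Ω : Type*} [MeasurableSpace Ω] (S : Set (Measure Ω))
    (hfin : ∀ ν ∈ S, IsFiniteMeasure ν) (hS : Halving S) (E : Set Ω) (hE : MeasurableSet E) :
    ∃ X : ℝ → Set Ω, (∀ t, MeasurableSet (X t)) ∧ Monotone X ∧ (∀ t, X t ⊆ E) ∧
      ∀ ν ∈ S, ∀ t, 0 ≤ t → t ≤ 1 → ν.real (X t) = t * ν.real E := by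
  choose h hm hsub hh using hS
  let H : Set Ω → Set Ω := fun A => open Classical in if hA : MeasurableSet A then h A hA else ∅
  have Hm : ∀ A, MeasurableSet A → MeasurableSet (H A) := fun A hA => by simp [H, hA, hm]
  have Hs : ∀ A, MeasurableSet A → H A ⊆ A := fun A hA => by simp [H, hA, hsub]
  have Hh : ∀ A, MeasurableSet A → ∀ ν ∈ S, ν.real (H A) = ν.real A / 2 := fun A hA ν hν => by
    simp [H, hA, hh A hA ν hν]
  let D : ℕ → ℕ → Set Ω := fun n => Nat.rec (fun k => if k = 0 then ∅ else E)
    (fun _ Dn k => if k % 2 = 0 then Dn (k/2) else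
      Dn (k/2) ∪ H (Dn (k/2+1) \ Dn (k/2))) n
  have D0 : ∀ k, D 0 k = if k = 0 then ∅ else E := fun k => rfl
  have DS : ∀ n k, D (n+1) k = if k % 2 = 0 then D n (k/2) else
      D n (k/2) ∪ H (D n (k/2+1) \ D n (k/2)) := fun n k => rfl
  have De : ∀ n k, D (n+1) (2*k) = D n k := fun n k => by
    rw [DS, if_pos (by omega)]; congr 1; omega
  have Do : ∀ n k, D (n+1) (2*k+1) = D n k ∪ H (D n (k+1) \ D n k) := fun n k => by
    rw [DS, if_neg (by omega), show (2*k+1)/2 = k by omega]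
  have Dm : ∀ n k, MeasurableSet (D n k) := by
    intro n
    induction n with
    | zero => intro k; rw [D0]; split_ifs; exacts [MeasurableSet.empty, hE]
    | succ n ih =>
      intro k
      rw [DS]; split_ifs
      exacts [ih _, (ih _).union (Hm _ ((ih _).diff (ih _)))]
  have Dmono : ∀ n, Monotone (D n) := by
    intro n
    induction n with
    | zero =>
      apply monotone_nat_of_le_succ
      intro k; rw [D0, D0, if_neg (Nat.succ_ne_zero k)]; split_ifs
      exacts [Set.empty_subset _, le_rfl]
    | succ n ih =>
      apply monotone_nat_of_le_succ
      intro k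
      obtain ⟨j, rfl | rfl⟩ : ∃ j, k = 2*j ∨ k = 2*j+1 := ⟨k/2, by omega⟩
      · rw [De, Do]; exact Set.subset_union_left
      · rw [Do, show 2*j+1+1 = 2*(j+1) by ring, De]
        exact Set.union_subset (ih (Nat.le_succ j))
          ((Hs _ ((Dm n _).diff (Dm n _))).trans Set.sdiff_subset)
  have DE : ∀ n k, D n k ⊆ E := by
    intro n
    induction n with
    | zero => intro k; rw [D0]; split_ifs; exacts [Set.empty_subset _, subset_rfl]
    | succ n ih =>
      intro k
      rw [DS]; split_ifs
      exacts [ih _, Set.union_subset (ih _)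
        (((Hs _ ((Dm n _).diff (Dm n _))).trans Set.sdiff_subset).trans (ih _))]
  have Dv : ∀ ν ∈ S, ∀ n k, k ≤ 2^n → ν.real (D n k) = k / 2^n * ν.real E := by
    intro ν hν n
    have := hfin ν hν
    induction n with
    | zero =>
      intro k hk
      rw [D0]
      have : k = 0 ∨ k = 1 := by simp at hk; omega
      rcases this with rfl | rfl <;> simp
    | succ n ih =>
      intro k hk
      rw [pow_succ] at hk
      obtain ⟨j, rfl | rfl⟩ : ∃ j, k = 2*j ∨ k = 2*j+1 := ⟨k/2, by omega⟩
      · rw [De, ih j (by omega), pow_succ]; push_cast; field_simp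
      · have hdm := (Dm n (j+1)).diff (Dm n j)
        rw [Do, measureReal_union _ (Hm _ hdm), Hh _ hdm ν hν,
          measureReal_sdiff (Dmono n (Nat.le_succ j)) (Dm n j), ih j (by omega),
          ih (j+1) (by omega), pow_succ]
        · push_cast; field_simp; ring
        · exact Set.disjoint_left.2 fun x hx hx' => (Hs _ hdm hx').2 hx
  refine ⟨fun t => ⋃ n : ℕ, D n ⌊t * 2^n⌋₊, fun t => MeasurableSet.iUnion fun n => Dm _ _,
    ?_, fun t => Set.iUnion_subset fun n => DE _ _, ?_⟩
  · intro s t hst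
    refine Set.iUnion_mono fun n => Dmono n (Nat.floor_le_floor ?_)
    gcongr
  · intro ν hν t ht0 ht1
    have := hfin ν hν
    have hmon : Monotone fun n : ℕ => D n ⌊t * 2^n⌋₊ := by
      apply monotone_nat_of_le_succ
      intro n
      rw [← De n]
      refine Dmono (n+1) ?_
      apply Nat.le_floor
      push_cast
      have := Nat.floor_le (show 0 ≤ t * 2^n by positivity)
      rw [pow_succ]; linarith
    have h1 := real_tendsto_iUnion ν _ hmon
    have h2 : Filter.Tendsto (fun n : ℕ => (⌊t * 2^n⌋₊ : ℝ) / 2^n * ν.real E) Filter.atTop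
        (nhds (t * ν.real E)) := by
      refine Filter.Tendsto.mul_const _ ?_
      exact (tendsto_nat_floor_mul_div_atTop ht0).comp
        (tendsto_pow_atTop_atTop_of_one_lt (by norm_num : (1:ℝ) < 2))
    refine tendsto_nhds_unique h1 (h2.congr fun n => ?_)
    rw [Dv ν hν]
    have h3 : t * 2^n ≤ ((2^n : ℕ) : ℝ) := by
      push_cast
      have : (0:ℝ) < 2^n := by positivity
      nlinarith
    exact (Nat.floor_le_floor h3).trans (by rw [Nat.floor_natCast])

lemma halving_insert {Ω : Type*} [MeasurableSpace Ω] (S : Set (Measure Ω))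
    (hfin : ∀ ν ∈ S, IsFiniteMeasure ν) (hS : Halving S) (σ ν : Measure Ω) (hσ : σ ∈ S)
    [IsFiniteMeasure ν] (hle : ∀ A, MeasurableSet A → ν.real A ≤ σ.real A) :
    Halving (insert ν S) := by
  intro E hE
  obtain ⟨X, Xm, Xmono, XE, Xv⟩ := halving_family S hfin hS E hE
  have := hfin σ hσ
  let g : ℝ → ℝ := fun t => ν.real (X t)
  have hg : ∀ s t, 0 ≤ s → s ≤ t → t ≤ 1 → |g t - g s| ≤ (t - s) * σ.real E := by
    intro s t hs hst ht
    have e1 : ν.real (X t \ X s) = g t - g s := measureReal_sdiff (Xmono hst) (Xm s)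
    have e2 : σ.real (X t \ X s) = σ.real (X t) - σ.real (X s) :=
      measureReal_sdiff (Xmono hst) (Xm s)
    rw [Xv σ hσ t (hs.trans hst) ht, Xv σ hσ s hs (hst.trans ht)] at e2
    rw [← e1, abs_of_nonneg measureReal_nonneg]
    have := hle _ ((Xm t).diff (Xm s))
    linarith
  have hgc : ContinuousOn g (Set.Icc 0 1) := by
    have : LipschitzOnWith ⟨σ.real E, measureReal_nonneg⟩ g (Set.Icc 0 1) := by
      apply LipschitzOnWith.of_dist_le_mul
      intro s hs t ht
      rw [Real.dist_eq, Real.dist_eq]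
      change _ ≤ σ.real E * _
      rcases le_total s t with hst | hst
      · rw [abs_sub_comm, abs_sub_comm s t, abs_of_nonneg (sub_nonneg.2 hst), mul_comm]
        exact hg s t hs.1 hst ht.2
      · rw [abs_of_nonneg (sub_nonneg.2 hst), mul_comm]
        exact hg t s ht.1 hst hs.2
    exact this.continuousOn
  let k : ℝ → ℝ := fun s => g (s + 1/2) - g s
  have hk : ContinuousOn k (Set.Icc 0 (1/2)) := by
    refine ContinuousOn.sub (hgc.comp (by fun_prop) ?_) (hgc.mono ?_)
    · intro s hs; constructor <;> linarith [hs.1, hs.2]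
    · intro s hs; constructor <;> linarith [hs.1, hs.2]
  have hX1 : g 1 = ν.real E := by
    have h1 : σ.real (E \ X 1) = 0 := by
      rw [measureReal_sdiff (XE 1) (Xm 1), Xv σ hσ 1 (by norm_num) le_rfl]; ring
    have h2 := hle _ (hE.diff (Xm 1))
    have h3 : ν.real (E \ X 1) = ν.real E - g 1 := measureReal_sdiff (XE 1) (Xm 1)
    have h4 : 0 ≤ ν.real (E \ X 1) := measureReal_nonneg
    linarith
  have hX0 : g 0 = 0 := by
    have h1 := Xv σ hσ 0 le_rfl (by norm_num)
    have h2 := hle _ (Xm 0)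
    have h4 : 0 ≤ ν.real (X 0) := measureReal_nonneg
    change ν.real (X 0) = 0
    linarith
  have k0 : k 0 = g (1/2) := by simp [k, hX0]
  have k1 : k (1/2) = ν.real E - g (1/2) := by
    simp only [k]; rw [← hX1]; norm_num
  obtain ⟨s, hs, hks⟩ : ∃ s ∈ Set.Icc (0:ℝ) (1/2), k s = ν.real E / 2 := by
    rcases le_total (g (1/2)) (ν.real E / 2) with hc | hc
    · exact intermediate_value_Icc (by norm_num) hk ⟨by rw [k0]; exact hc, by rw [k1]; linarith⟩
    · exact intermediate_value_Icc' (by norm_num) hk ⟨by rw [k1]; linarith, by rw [k0]; exact hc⟩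
  have hle' : s ≤ s + 1/2 := by linarith
  refine ⟨X (s + 1/2) \ X s, (Xm _).diff (Xm _), Set.sdiff_subset.trans (XE _), ?_⟩
  rintro μ (rfl | hμ)
  · rw [measureReal_sdiff (Xmono hle') (Xm s)]; exact hks
  · have := hfin μ hμ
    rw [measureReal_sdiff (Xmono hle') (Xm s), Xv μ hμ _ (by linarith [hs.1]) (by linarith [hs.2]),
      Xv μ hμ s hs.1 (by linarith [hs.2])]
    ring

/-- Simultaneous proportional splitting for three non-atomic finite measures. -/
lemma split_three {Ω : Type*} [MeasurableSpace Ω] (π : Fin 3 → Measure Ω)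
    [∀ j, IsFiniteMeasure (π j)] (h : ∀ j, RNonatomic (π j)) (E : Set Ω) (hE : MeasurableSet E)
    (t : ℝ) (ht0 : 0 ≤ t) (ht1 : t ≤ 1) :
    ∃ F, MeasurableSet F ∧ F ⊆ E ∧ ∀ j, (π j).real F = t * (π j).real E := by
  let σ : Measure Ω := π 0 + π 1 + π 2
  have hσ : ∀ A, σ.real A = (π 0).real A + (π 1).real A + (π 2).real A := by
    intro A
    simp only [σ]
    rw [measureReal_add_apply, measureReal_add_apply]
  have hna : RNonatomic σ := by
    intro A hA hpos
    have : ∃ j, 0 < (π j).real A := by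
      by_contra hcon
      push Not at hcon
      rw [hσ] at hpos
      linarith [hcon 0, hcon 1, hcon 2]
    obtain ⟨j, hj⟩ := this
    obtain ⟨F, hF, hFA, hF0, hF1⟩ := h j A hA hj
    have hm : ∀ j, (π j).real F ≤ (π j).real A := fun j => measureReal_mono hFA
    have hp : ∀ j, 0 ≤ (π j).real F := fun j => measureReal_nonneg
    have m0 := hm 0
    have m1 := hm 1
    have m2 := hm 2
    have p0 := hp 0
    have p1 := hp 1
    have p2 := hp 2
    refine ⟨F, hF, hFA, ?_, ?_⟩
    · rw [hσ]; fin_cases j <;> simp at hF0 <;> linarith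
    · rw [hσ, hσ]; fin_cases j <;> simp at hF1 <;> linarith
  have h0 : Halving {σ} := by
    intro A hA
    have hp : 0 ≤ σ.real A := measureReal_nonneg
    obtain ⟨F, hF, hFA, hv⟩ := sierpinski σ hna A hA (σ.real A / 2) (by linarith) (by linarith)
    exact ⟨F, hF, hFA, by simpa using hv⟩
  have hle : ∀ j, ∀ A, MeasurableSet A → (π j).real A ≤ σ.real A := by
    intro j A _
    have hp : ∀ j, 0 ≤ (π j).real A := fun j => measureReal_nonneg
    have p0 := hp 0
    have p1 := hp 1
    have p2 := hp 2
    rw [hσ]; fin_cases j <;> simp <;> linarith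
  have f0 : ∀ ν ∈ ({σ} : Set (Measure Ω)), IsFiniteMeasure ν := by
    rintro ν rfl; infer_instance
  have h1 := halving_insert _ f0 h0 σ (π 1) (by simp) (hle 1)
  have f1 : ∀ ν ∈ ({π 1, σ} : Set (Measure Ω)), IsFiniteMeasure ν := by
    rintro ν (rfl | hν)
    exacts [inferInstance, f0 ν hν]
  have h2 := halving_insert _ f1 h1 σ (π 2) (by simp) (hle 2)
  have f2 : ∀ ν ∈ ({π 2, π 1, σ} : Set (Measure Ω)), IsFiniteMeasure ν := by
    rintro ν (rfl | hν)
    exacts [inferInstance, f1 ν hν]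
  obtain ⟨X, Xm, -, XE, Xv⟩ := halving_family _ f2 h2 E hE
  refine ⟨X t, Xm t, XE t, ?_⟩
  have v1 := Xv (π 1) (by simp) t ht0 ht1
  have v2 := Xv (π 2) (by simp) t ht0 ht1
  have v3 := Xv σ (by simp) t ht0 ht1
  rw [hσ, hσ] at v3
  intro j
  fin_cases j <;> simp
  · linarith
  · exact v1
  · exact v2

lemma lottery_act {Ω O : Type*} [MeasurableSpace Ω] [MeasurableSpace O] [Nonempty O]
    (π : Fin 3 → Measure Ω)
    [∀ j, IsFiniteMeasure (π j)] (h : ∀ j, RNonatomic (π j)) (w : O → ℝ) (hw : ∀ x, 0 ≤ w x)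
    (s : Finset O) : ∀ (E : Set Ω), MeasurableSet E → (∀ j, (π j).real E = ∑ x ∈ s, w x) →
    ∃ f : Ω → O, Measurable f ∧ ∀ j, Measure.map f ((π j).restrict E) =
      ∑ x ∈ s, ENNReal.ofReal (w x) • Measure.dirac x := by
  classical
  induction s using Finset.induction_on with
  | empty =>
    intro E hE hv
    refine ⟨fun _ => Classical.arbitrary O, measurable_const, fun j => ?_⟩
    have : (π j) E = 0 := by
      have := hv j
      simpa [measureReal_eq_zero_iff] using this
    simp [Measure.restrict_eq_zero.2 this]
  | insert x s hx ih =>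
    intro E hE hv
    rw [Finset.sum_insert hx] at hv
    have hsum : 0 ≤ ∑ x ∈ s, w x := Finset.sum_nonneg fun y _ => hw y
    set e := w x + ∑ x ∈ s, w x with he
    have hwx := hw x
    obtain ⟨F, hF, hFE, hFv⟩ := split_three π h E hE (w x / e)
      (div_nonneg hwx (by linarith)) (div_le_one_of_le₀ (by linarith) (by linarith))
    have hFv' : ∀ j, (π j).real F = w x := by
      intro j
      rw [hFv j, hv j]
      by_cases h0 : e = 0
      · have : w x = 0 := by linarith
        simp [h0, this]
      · field_simp
    obtain ⟨f, hf, hfm⟩ := ih (E \ F) (hE.diff hF) (fun j => by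
      rw [measureReal_sdiff hFE hF, hv, hFv', he]; ring)
    refine ⟨F.piecewise (fun _ => x) f, measurable_const.piecewise hF hf, fun j => ?_⟩
    have hpm : Measurable (F.piecewise (fun _ => x) f) := measurable_const.piecewise hF hf
    have hsplit : (π j).restrict E = (π j).restrict F + (π j).restrict (E \ F) := by
      rw [← Measure.restrict_union Set.disjoint_sdiff_right (hE.diff hF),
        Set.union_sdiff_cancel hFE]
    rw [hsplit, Measure.map_add _ _ hpm, Finset.sum_insert hx, ← hfm j]
    congr 1
    · have : F.piecewise (fun _ => x) f =ᵐ[(π j).restrict F] fun _ => x := by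
        filter_upwards [ae_restrict_mem hF] with ω hω
        simp [hω]
      rw [Measure.map_congr this, Measure.map_const, ← hFv' j]
      simp
    · apply Measure.map_congr
      filter_upwards [ae_restrict_mem (hE.diff hF)] with ω hω
      simp [hω.2]

lemma IsBelief.rnonatomic {Ω : Type*} [MeasurableSpace Ω] {π : Measure Ω} (h : IsBelief π) :
    RNonatomic π := by
  have := h.1
  intro E hE hpos
  have hpos' : 0 < π E := (ENNReal.toReal_pos_iff.1 hpos).1
  obtain ⟨F, hF, hFE, h0, h1⟩ := h.2 E hE hpos'
  exact ⟨F, hF, hFE, ENNReal.toReal_pos h0.ne' (measure_ne_top _ _),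
    (ENNReal.toReal_lt_toReal (measure_ne_top _ _) (measure_ne_top _ _)).2 h1⟩

lemma NormalizedUtilityBar.isUtility {O : Type*} [MeasurableSpace O] {u : O → ℝ}
    (h : NormalizedUtilityBar u) : IsUtility u := by
  rcases h with ⟨hm, h0, h1⟩ | rfl
  · refine ⟨hm, 1, fun x => ?_⟩
    have a := h0.1 ⟨x, rfl⟩
    have b := h1.1 ⟨x, rfl⟩
    rw [abs_of_nonneg a]; exact b
  · exact ⟨measurable_const, 0, fun x => by simp⟩

lemma NormRep.representsBelief {Ω O : Type*} [MeasurableSpace Ω] [MeasurableSpace O]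
    {π : Measure Ω} {u : O → ℝ} {r : Pref Ω O} (h : NormRep π u r) : RepresentsBelief π r :=
  ⟨h.1, u, h.2.1.isUtility, h.2.2⟩

lemma ev_of_map {Ω O : Type*} [MeasurableSpace Ω] [MeasurableSpace O]
    {π : Measure Ω} {u : O → ℝ} (hu : Measurable u) (f : Act Ω O) (w : O → ℝ)
    (hw : ∀ x, 0 ≤ w x) (s : Finset O)
    (hm : Measure.map f.1 π = ∑ x ∈ s, ENNReal.ofReal (w x) • Measure.dirac x) :
    ev π u f = ∑ x ∈ s, w x * u x := by
  have h1 : ev π u f = ∫ x, u x ∂(Measure.map f.1 π) :=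
    (integral_map f.2.aemeasurable hu.aestronglyMeasurable).symm
  rw [h1, hm, integral_finsetSum_measure]
  · refine Finset.sum_congr rfl fun x _ => ?_
    rw [integral_smul_measure, integral_dirac' _ _ hu.stronglyMeasurable,
      ENNReal.toReal_ofReal (hw x), smul_eq_mul]
  · intro x _
    refine Integrable.smul_measure ?_ ENNReal.ofReal_ne_top
    exact integrable_dirac' hu.stronglyMeasurable (by simp)

lemma key_mono {Ω O I : Type*} [mΩ : MeasurableSpace Ω] [mO : MeasurableSpace O] [Nonempty O]
    (Φ : (I → Pref Ω O) → Pref Ω O)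
    (hmono : RestrictedMonotonicity Φ)
    (i : I) (p : I → Pref Ω O) (hp : IsProfile p)
    (πi : Measure Ω) (ui : O → ℝ) (hrepi : NormRep πi ui (p i))
    (πp : Measure Ω) (up : O → ℝ) (hrepp : NormRep πp up (Φ p))
    (πsi : Measure Ω) (usi : O → ℝ)
    (hrepsi : NormRep πsi usi (Φ (updIndiff p i))) (d : O →₀ ℝ)
    (hd1 : Finsupp.linearCombination ℝ (fun _ : O => (1:ℝ)) d = 0)
    (hd2 : Finsupp.linearCombination ℝ usi d = 0) :
    (0 ≤ Finsupp.linearCombination ℝ ui d → 0 ≤ Finsupp.linearCombination ℝ up d) ∧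
    (0 < Finsupp.linearCombination ℝ ui d → 0 < Finsupp.linearCombination ℝ up d) := by
  have hL : ∀ u : O → ℝ, Finsupp.linearCombination ℝ u d = ∑ x ∈ d.support, d x * u x :=
    fun u => rfl
  rw [hL] at hd1 hd2
  rw [hL, hL]
  by_cases hd : d = 0
  · subst hd; simp
  set n := ∑ x ∈ d.support, |d x| with hn
  have hnpos : 0 < n := by
    obtain ⟨x, hx⟩ := Finsupp.support_nonempty_iff.2 hd
    exact Finset.sum_pos (fun y hy => abs_pos.2 (Finsupp.mem_support_iff.1 hy)) ⟨x, hx⟩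
  simp only [mul_one] at hd1
  let w1 : O → ℝ := fun x => (|d x| + d x) / n
  let w2 : O → ℝ := fun x => (|d x| - d x) / n
  have hw1 : ∀ x, 0 ≤ w1 x := fun x => div_nonneg (by linarith [neg_abs_le (d x)]) hnpos.le
  have hw2 : ∀ x, 0 ≤ w2 x := fun x => div_nonneg (by linarith [le_abs_self (d x)]) hnpos.le
  have hs1 : ∑ x ∈ d.support, w1 x = 1 := by
    simp only [w1]
    rw [← Finset.sum_div, Finset.sum_add_distrib, hd1, add_zero, div_self hnpos.ne']
  have hs2 : ∑ x ∈ d.support, w2 x = 1 := by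
    simp only [w2]
    rw [← Finset.sum_div, Finset.sum_sub_distrib, hd1, sub_zero, div_self hnpos.ne']
  let π : Fin 3 → Measure Ω := ![πsi, πi, πp]
  have hb : ∀ j, IsBelief (π j) := by
    intro j; fin_cases j
    exacts [hrepsi.1, hrepi.1, hrepp.1]
  have hpr : ∀ j, IsProbabilityMeasure (π j) := fun j => (hb j).1
  have hna : ∀ j, RNonatomic (π j) := fun j => (hb j).rnonatomic
  obtain ⟨f, hf, hfm⟩ := lottery_act π hna w1 hw1 d.support Set.univ MeasurableSet.univ
    (fun j => by rw [hs1]; simp)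
  obtain ⟨g, hg, hgm⟩ := lottery_act π hna w2 hw2 d.support Set.univ MeasurableSet.univ
    (fun j => by rw [hs2]; simp)
  simp only [Measure.restrict_univ] at hfm hgm
  have hev : ∀ j (u : O → ℝ), Measurable u → ev (π j) u ⟨f, hf⟩ - ev (π j) u ⟨g, hg⟩ =
      2 / n * ∑ x ∈ d.support, d x * u x := by
    intro j u hu
    rw [ev_of_map hu ⟨f, hf⟩ w1 hw1 _ (hfm j), ev_of_map hu ⟨g, hg⟩ w2 hw2 _ (hgm j),
      ← Finset.sum_sub_distrib, Finset.mul_sum]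
    refine Finset.sum_congr rfl fun x _ => ?_
    simp only [w1, w2]; ring
  have e0 := hev 0 usi hrepsi.2.1.isUtility.1
  have e1 := hev 1 ui hrepi.2.1.isUtility.1
  have e2 := hev 2 up hrepp.2.1.isUtility.1
  change ev πsi usi _ - ev πsi usi _ = _ at e0
  change ev πi ui _ - ev πi ui _ = _ at e1
  change ev πp up _ - ev πp up _ = _ at e2
  rw [hd2, mul_zero] at e0
  have hc : 0 < 2 / n := by positivity
  obtain ⟨m1, m2⟩ := hmono i p hp πsi πi hrepsi.representsBelief hrepi.representsBelief
    ⟨f, hf⟩ ⟨g, hg⟩ ((hrepsi.2.2 _ _).2 (by linarith)) ((hrepsi.2.2 _ _).2 (by linarith))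
    ((hfm 0).trans (hfm 1).symm) ((hgm 0).trans (hgm 1).symm)
  rw [hrepi.2.2, hrepp.2.2] at m1
  rw [hrepi.2.2, hrepi.2.2, hrepp.2.2, hrepp.2.2] at m2
  constructor
  · intro h
    have := m1 (by have := mul_nonneg hc.le h; linarith)
    exact nonneg_of_mul_nonneg_right (by linarith : 0 ≤ 2 / n * _) hc
  · intro h
    have h' := mul_pos hc h
    have := (m2 ⟨by linarith, by linarith⟩).2
    exact pos_of_mul_pos_right (by linarith : 0 < 2 / n * _) hc.le

lemma lc_single {O : Type*} (u : O → ℝ) (x : O) :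
    Finsupp.linearCombination ℝ u (Finsupp.single x 1) = u x := by simp

theorem stmt4 {Ω O I : Type*} [mΩ : MeasurableSpace Ω] [mO : MeasurableSpace O]
    [Fintype I] (hO : 4 ≤ Cardinal.mk O) (hI : 3 ≤ Fintype.card I)
    (Φ : (I → Pref Ω O) → Pref Ω O)
    (hSWF : ∀ p : I → Pref Ω O, IsProfile p → IsSEU (Φ p))
    (hmono : RestrictedMonotonicity Φ)
    (i : I) (p : I → Pref Ω O) (hp : IsProfile p)
    (hi : ¬ CompletelyIndifferent (p i))
    (πi : Measure Ω) (ui : O → ℝ) (hrepi : NormRep πi ui (p i))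
    (πp : Measure Ω) (up : O → ℝ) (hrepp : NormRep πp up (Φ p))
    (πsi : Measure Ω) (usi : O → ℝ)
    (hrepsi : NormRep πsi usi (Φ (updIndiff p i))) :
    (∃ α β : ℝ, UEquiv up (fun x => α * usi x + β * ui x)) ∧
    (¬ UEquiv ui usi → ¬ UEquiv ui (fun x => - usi x) →
      ¬ UEquiv usi (fun _ => 0) →
      ∃ α β : ℝ, 0 < β ∧ UEquiv up (fun x => α * usi x + β * ui x) ∧
        ∀ α' β' : ℝ, UEquiv up (fun x => α' * usi x + β' * ui x) →
          ∃ c : ℝ, 0 < c ∧ α' = c * α ∧ β' = c * β) := by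
  have hOne : Nonempty O := by
    by_contra hcon
    rw [not_nonempty_iff] at hcon
    rw [Cardinal.mk_eq_zero] at hO
    norm_num at hO
  have key := key_mono Φ hmono i p hp πi ui hrepi πp up hrepp πsi usi hrepsi
  obtain ⟨α, β, γ, hrep⟩ : ∃ α β γ : ℝ, ∀ x, up x = α * usi x + β * ui x + γ := by
    have hspan := mem_span_of_iInf_ker_le_ker (𝕜 := ℝ)
      (L := ![Finsupp.linearCombination ℝ usi, Finsupp.linearCombination ℝ ui,
        Finsupp.linearCombination ℝ (fun _ : O => (1:ℝ))])
      (K := Finsupp.linearCombination ℝ up) (by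
        intro d hd
        simp only [Submodule.mem_iInf, LinearMap.mem_ker] at hd ⊢
        have d0 : Finsupp.linearCombination ℝ usi d = 0 := hd 0
        have d1 : Finsupp.linearCombination ℝ ui d = 0 := hd 1
        have d2 : Finsupp.linearCombination ℝ (fun _ : O => (1:ℝ)) d = 0 := hd 2
        have k1 := (key d d2 d0).1 d1.ge
        have k2 := (key (-d) (by rw [map_neg, d2, neg_zero]) (by rw [map_neg, d0, neg_zero])).1
          (by rw [map_neg, d1, neg_zero])
        rw [map_neg] at k2
        linarith)
    obtain ⟨c, hc⟩ := (Submodule.mem_span_range_iff_exists_fun ℝ).1 hspan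
    refine ⟨c 0, c 1, c 2, fun x => ?_⟩
    have := congrArg (fun l => l (Finsupp.single x 1)) hc
    simp [Fin.sum_univ_three] at this
    linarith
  refine ⟨⟨α, β, 1, one_pos, γ, fun x => by rw [hrep]; ring⟩, ?_⟩
  intro hne1 hne2 hnc
  have hindep : ∀ a b : ℝ, ¬ ∀ x, ui x = a * usi x + b := by
    intro a b hab
    rcases lt_trichotomy a 0 with ha | ha | ha
    · exact hne2 ⟨-a, by linarith, b, fun x => by rw [hab]; ring⟩
    · apply hi
      intro f g
      have := hrepi.1.1
      rw [hrepi.2.2]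
      simp [ev, hab, ha]
    · exact hne1 ⟨a, ha, b, hab⟩
  have hβ : 0 < β := by
    obtain ⟨d, d1, d2, d3⟩ : ∃ d : O →₀ ℝ,
        Finsupp.linearCombination ℝ (fun _ : O => (1:ℝ)) d = 0 ∧
        Finsupp.linearCombination ℝ usi d = 0 ∧ 0 < Finsupp.linearCombination ℝ ui d := by
      by_contra hcon
      push Not at hcon
      have hspan := mem_span_of_iInf_ker_le_ker (𝕜 := ℝ)
        (L := ![Finsupp.linearCombination ℝ usi,
          Finsupp.linearCombination ℝ (fun _ : O => (1:ℝ))])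
        (K := Finsupp.linearCombination ℝ ui) (by
          intro d hd
          simp only [Submodule.mem_iInf, LinearMap.mem_ker] at hd ⊢
          have d0 : Finsupp.linearCombination ℝ usi d = 0 := hd 0
          have d2 : Finsupp.linearCombination ℝ (fun _ : O => (1:ℝ)) d = 0 := hd 1
          have k1 := hcon d d2 d0
          have k2 := hcon (-d) (by rw [map_neg, d2, neg_zero]) (by rw [map_neg, d0, neg_zero])
          rw [map_neg] at k2
          linarith)
      obtain ⟨c, hc⟩ := (Submodule.mem_span_range_iff_exists_fun ℝ).1 hspan
      refine hindep (c 0) (c 1) fun x => ?_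
      have := congrArg (fun l => l (Finsupp.single x 1)) hc
      simp [Fin.sum_univ_two] at this
      linarith
    have h1 := (key d d1 d2).2 d3
    have h2 : Finsupp.linearCombination ℝ up d = α * Finsupp.linearCombination ℝ usi d +
        β * Finsupp.linearCombination ℝ ui d +
        γ * Finsupp.linearCombination ℝ (fun _ : O => (1:ℝ)) d := by
      simp only [Finsupp.linearCombination_apply, Finsupp.sum, smul_eq_mul, Finset.mul_sum,
        ← Finset.sum_add_distrib]
      refine Finset.sum_congr rfl fun x _ => ?_
      rw [hrep]; ring
    rw [h2, d1, d2] at h1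
    simp only [mul_zero, zero_add, add_zero] at h1
    exact pos_of_mul_pos_left h1 d3.le
  refine ⟨α, β, hβ, ⟨1, one_pos, γ, fun x => by rw [hrep]; ring⟩, ?_⟩
  rintro α' β' ⟨a, ha, b, hab⟩
  have heq : ∀ x, (β - a * β') * ui x = (a * α' - α) * usi x + (b - γ) := by
    intro x
    have h1 := hrep x
    have h2 := hab x
    simp only at h2
    linarith
  have hb : β - a * β' = 0 := by
    by_contra hne
    refine hindep ((a * α' - α) / (β - a * β')) ((b - γ) / (β - a * β')) fun x => ?_
    have := heq x
    field_simp
    linarith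
  have hal : a * α' - α = 0 := by
    by_contra hne
    refine hnc ⟨1, one_pos, -(b - γ) / (a * α' - α), fun x => ?_⟩
    have := heq x
    rw [hb] at this
    field_simp
    linarith
  refine ⟨a⁻¹, inv_pos.2 ha, ?_, ?_⟩
  · field_simp; linarith
  · field_simp; linarith
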